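/- arXiv:2311.07219 — 5 statements merged into one kernel-verified Lean document; each statement's English description precedes it below -/
import Mathlib

section
/- Let G = (V,E) be a finite simple graph with a co-comparability ordering ≺, and let I₁, I₂ be two maximum independent sets of G (i.e., independent sets of size α(G)). If v ∈ I₁ ∩ I₂, then pos_{I₁}(v) = pos_{I₂}(v). -/
/-- An independent set (as a finset): pairwise non-adjacent vertices. -/
def IsIndep {V : Type*} (G : SimpleGraph V) (I : Finset V) : Prop :=
  ∀ u ∈ I, ∀ v ∈ I, u ≠ v → ¬ G.Adj u v

/-- The independence number `α(G)`: the maximum size of an independent set. -/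
noncomputable def indepNum {V : Type*} (G : SimpleGraph V) : ℕ :=
  sSup {n | ∃ I : Finset V, IsIndep G I ∧ I.card = n}

/-- `pos_I(v) = |{u ∈ I : u ≺ v}| + 1`. -/
def posIn {V : Type*} [LinearOrder V] (I : Finset V) (v : V) : ℕ :=
  (I.filter fun u => u < v).card + 1

theorem IsIndep.card_le_indepNum {V : Type*} [Fintype V] {G : SimpleGraph V} {I : Finset V}
    (h : IsIndep G I) : I.card ≤ indepNum G :=
  le_csSup ⟨Fintype.card V, by rintro _ ⟨J, -, rfl⟩; exact J.card_le_univ⟩ ⟨I, h, rfl⟩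

/-- Independent sets sharing a vertex `v` can be spliced at `v`. -/
theorem IsIndep.splice {V : Type*} [LinearOrder V] {G : SimpleGraph V}
    (hco : ∀ u v w : V, u < v → v < w → ¬ G.Adj u v → ¬ G.Adj v w → ¬ G.Adj u w)
    {I J : Finset V} (hI : IsIndep G I) (hJ : IsIndep G J) {v : V} (hvI : v ∈ I) (hvJ : v ∈ J) :
    IsIndep G ((I.filter fun u => u < v) ∪ J.filter fun u => ¬ u < v) := by
  have cross : ∀ a ∈ I, a < v → ∀ b ∈ J, ¬ b < v → ¬ G.Adj a b := by
    intro a ha hav b hb hbv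
    rcases (not_lt.mp hbv).eq_or_lt with rfl | hvb
    · exact hI a ha v hvI hav.ne
    · exact hco a v b hav hvb (hI a ha v hvI hav.ne) (hJ v hvJ b hb hvb.ne)
  intro a ha b hb hab
  simp only [Finset.mem_union, Finset.mem_filter] at ha hb
  rcases ha with ⟨ha, hav⟩ | ⟨ha, hav⟩ <;> rcases hb with ⟨hb, hbv⟩ | ⟨hb, hbv⟩
  · exact hI a ha b hb hab
  · exact cross a ha hav b hb hbv
  · exact fun h => cross b hb hbv a ha hav h.symm
  · exact hJ a ha b hb hab

theorem posIn_le_posIn_of_card_eq_indepNum {V : Type*} [Fintype V] [LinearOrder V]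
    {G : SimpleGraph V}
    (hco : ∀ u v w : V, u < v → v < w → ¬ G.Adj u v → ¬ G.Adj v w → ¬ G.Adj u w)
    {I J : Finset V} (hI : IsIndep G I) (hJ : IsIndep G J) (hJcard : J.card = indepNum G)
    {v : V} (hvI : v ∈ I) (hvJ : v ∈ J) : posIn I v ≤ posIn J v := by
  have hle := (hI.splice hco hJ hvI hvJ).card_le_indepNum
  rw [Finset.card_union_of_disjoint (Finset.disjoint_filter_filter_not _ _ _), ← hJcard,
    ← Finset.card_filter_add_card_filter_not (s := J) (fun u => u < v)] at hle
  exact Nat.succ_le_succ (Nat.le_of_add_le_add_right hle)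

/-- In a finite graph with a co-comparability ordering, if `I₁`, `I₂`
are maximum independent sets and `v ∈ I₁ ∩ I₂`, then `pos_{I₁}(v) = pos_{I₂}(v)`. -/
theorem stmt4 {V : Type*} [Fintype V] [LinearOrder V] (G : SimpleGraph V)
    (hco : ∀ u v w : V, u < v → v < w → ¬ G.Adj u v → ¬ G.Adj v w → ¬ G.Adj u w)
    (I₁ I₂ : Finset V)
    (h1 : IsIndep G I₁) (h1card : I₁.card = indepNum G)
    (h2 : IsIndep G I₂) (h2card : I₂.card = indepNum G)
    (v : V) (hv1 : v ∈ I₁) (hv2 : v ∈ I₂) :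
    posIn I₁ v = posIn I₂ v := by
  exact le_antisymm (posIn_le_posIn_of_card_eq_indepNum hco h1 h2 h2card hv1 hv2)
    (posIn_le_posIn_of_card_eq_indepNum hco h2 h1 h1card hv2 hv1)
end

section
/- Let G = (V,E) be a finite simple graph with a co-comparability ordering ≺, and let v ∈ V. The maximum cardinality of an independent set of G containing v equals 1 plus the maximum cardinality of a left extension of v plus the maximum cardinality of a right extension of v. -/
/-- A left extension of `v`: an independent set all of whose vertices are
before `v` in the ordering and non-adjacent to `v`. -/
def IsLeftExt {V : Type*} [LinearOrder V] (G : SimpleGraph V) (v : V) (I : Finset V) : Prop :=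
  IsIndep G I ∧ ∀ u ∈ I, u < v ∧ ¬ G.Adj u v

/-- A right extension of `v`: an independent set all of whose vertices are
after `v` in the ordering and non-adjacent to `v`. -/
def IsRightExt {V : Type*} [LinearOrder V] (G : SimpleGraph V) (v : V) (I : Finset V) : Prop :=
  IsIndep G I ∧ ∀ u ∈ I, v < u ∧ ¬ G.Adj u v

/-- The maximum cardinality of a left extension of `v`. -/
noncomputable def leftExtNum {V : Type*} [LinearOrder V] (G : SimpleGraph V) (v : V) : ℕ :=
  sSup {n | ∃ I : Finset V, IsLeftExt G v I ∧ I.card = n}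

/-- The maximum cardinality of a right extension of `v`. -/
noncomputable def rightExtNum {V : Type*} [LinearOrder V] (G : SimpleGraph V) (v : V) : ℕ :=
  sSup {n | ∃ I : Finset V, IsRightExt G v I ∧ I.card = n}

/-- The maximum cardinality of an independent set containing `v`. -/
noncomputable def indepOnNum {V : Type*} (G : SimpleGraph V) (v : V) : ℕ :=
  sSup {n | ∃ I : Finset V, IsIndep G I ∧ v ∈ I ∧ I.card = n}

theorem bddAbove_card {V : Type*} [Fintype V] (P : Finset V → Prop) :
    BddAbove {n | ∃ I : Finset V, P I ∧ I.card = n} :=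
  ⟨Fintype.card V, by rintro n ⟨I, -, rfl⟩; exact I.card_le_univ⟩

theorem card_le_sSup_card {V : Type*} [Fintype V] {P : Finset V → Prop} {I : Finset V}
    (hI : P I) : I.card ≤ sSup {n | ∃ I : Finset V, P I ∧ I.card = n} :=
  le_csSup (bddAbove_card P) ⟨I, hI, rfl⟩

theorem exists_card_eq_sSup_card {V : Type*} [Fintype V] {P : Finset V → Prop} {I : Finset V}
    (hI : P I) : ∃ J, P J ∧ J.card = sSup {n | ∃ I : Finset V, P I ∧ I.card = n} :=
  Nat.sSup_mem (s := {n | ∃ I : Finset V, P I ∧ I.card = n}) ⟨_, I, hI, rfl⟩ (bddAbove_card P)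

theorem IsIndep.mono {V : Type*} {G : SimpleGraph V} {I J : Finset V} (hJ : IsIndep G J)
    (hIJ : I ⊆ J) : IsIndep G I :=
  fun u hu w hw => hJ u (hIJ hu) w (hIJ hw)

theorem isIndep_empty {V : Type*} (G : SimpleGraph V) : IsIndep G ∅ := by
  simp [IsIndep]

/-- Under a co-comparability ordering, a left and a right extension of `v` are jointly independent,
also together with `v`. -/
theorem IsLeftExt.isIndep_insert_union {V : Type*} [LinearOrder V] {G : SimpleGraph V}
    (hco : ∀ u v w : V, u < v → v < w → ¬ G.Adj u v → ¬ G.Adj v w → ¬ G.Adj u w)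
    {v : V} {L R : Finset V} (hL : IsLeftExt G v L) (hR : IsRightExt G v R) :
    IsIndep G (insert v (L ∪ R)) := by
  have hLR : ∀ a ∈ L, ∀ b ∈ R, ¬ G.Adj a b := fun a ha b hb =>
    hco a v b (hL.2 a ha).1 (hR.2 b hb).1 (hL.2 a ha).2 fun h => (hR.2 b hb).2 h.symm
  intro a ha b hb hab
  simp only [Finset.mem_insert, Finset.mem_union] at ha hb
  rcases ha with rfl | ha | ha <;> rcases hb with rfl | hb | hb
  · exact absurd rfl hab
  · exact fun h => (hL.2 b hb).2 h.symm
  · exact fun h => (hR.2 b hb).2 h.symm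
  · exact (hL.2 a ha).2
  · exact hL.1 a ha b hb hab
  · exact hLR a ha b hb
  · exact (hR.2 a ha).2
  · exact fun h => hLR b hb a ha h.symm
  · exact hR.1 a ha b hb hab

theorem IsLeftExt.card_insert_union {V : Type*} [LinearOrder V] {G : SimpleGraph V}
    {v : V} {L R : Finset V} (hL : IsLeftExt G v L) (hR : IsRightExt G v R) :
    (insert v (L ∪ R)).card = 1 + L.card + R.card := by
  have hv : v ∉ L ∪ R := fun h => (Finset.mem_union.1 h).elim
    (fun h => (hL.2 v h).1.false) (fun h => (hR.2 v h).1.false)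
  have hd : Disjoint L R := Finset.disjoint_left.2 fun a ha hb =>
    ((hL.2 a ha).1.trans (hR.2 a hb).1).false
  rw [Finset.card_insert_of_notMem hv, Finset.card_union_of_disjoint hd]
  omega

theorem IsIndep.isLeftExt_filter {V : Type*} [LinearOrder V] {G : SimpleGraph V} {v : V}
    {I : Finset V} (hI : IsIndep G I) (hv : v ∈ I) : IsLeftExt G v (I.filter (· < v)) := by
  refine ⟨hI.mono (Finset.filter_subset _ _), fun u hu => ?_⟩
  obtain ⟨huI, huv⟩ := Finset.mem_filter.1 hu
  exact ⟨huv, hI u huI v hv huv.ne⟩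

theorem IsIndep.isRightExt_filter {V : Type*} [LinearOrder V] {G : SimpleGraph V} {v : V}
    {I : Finset V} (hI : IsIndep G I) (hv : v ∈ I) : IsRightExt G v (I.filter (v < ·)) := by
  refine ⟨hI.mono (Finset.filter_subset _ _), fun u hu => ?_⟩
  obtain ⟨huI, hvu⟩ := Finset.mem_filter.1 hu
  exact ⟨hvu, hI u huI v hv hvu.ne'⟩

theorem insert_filter_lt_union_filter_gt {V : Type*} [LinearOrder V] {v : V} {I : Finset V}
    (hv : v ∈ I) : insert v (I.filter (· < v) ∪ I.filter (v < ·)) = I := by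
  ext a
  simp only [Finset.mem_insert, Finset.mem_union, Finset.mem_filter]
  rcases lt_trichotomy a v with h | rfl | h
  · simp [h, h.ne, h.not_gt]
  · simp [hv]
  · simp [h, h.ne', h.not_gt]

/-- In a finite graph with a co-comparability ordering, the maximum
cardinality of an independent set containing `v` equals `1` plus the maximum cardinality
of a left extension of `v` plus the maximum cardinality of a right extension of `v`. -/
theorem stmt7 {V : Type*} [Fintype V] [LinearOrder V] (G : SimpleGraph V)
    (hco : ∀ u v w : V, u < v → v < w → ¬ G.Adj u v → ¬ G.Adj v w → ¬ G.Adj u w)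
    (v : V) :
    indepOnNum G v = 1 + leftExtNum G v + rightExtNum G v := by
  obtain ⟨L, hL, hLn⟩ := exists_card_eq_sSup_card (P := IsLeftExt G v)
    (I := ∅) ⟨isIndep_empty G, by simp⟩
  obtain ⟨R, hR, hRn⟩ := exists_card_eq_sSup_card (P := IsRightExt G v)
    (I := ∅) ⟨isIndep_empty G, by simp⟩
  have hnum : indepOnNum G v =
      sSup {n | ∃ I : Finset V, (IsIndep G I ∧ v ∈ I) ∧ I.card = n} := by
    simp only [indepOnNum, and_assoc]
  have hins : IsIndep G (insert v (L ∪ R)) ∧ v ∈ insert v (L ∪ R) :=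
    ⟨hL.isIndep_insert_union hco hR, Finset.mem_insert_self _ _⟩
  obtain ⟨I, ⟨hI, hv⟩, hIn⟩ := exists_card_eq_sSup_card
    (P := fun I => IsIndep G I ∧ v ∈ I) hins
  rw [hnum, leftExtNum, rightExtNum]
  apply le_antisymm
  · have hl := hI.isLeftExt_filter hv
    have hr := hI.isRightExt_filter hv
    have hcard := hl.card_insert_union hr
    rw [insert_filter_lt_union_filter_gt hv] at hcard
    rw [← hIn, hcard]
    gcongr
    · exact card_le_sSup_card hl
    · exact card_le_sSup_card hr
  · rw [← hLn, ← hRn, ← hL.card_insert_union hR]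
    exact card_le_sSup_card (P := fun I => IsIndep G I ∧ v ∈ I) hins
end

section
/- Let G = (V,E) be a finite simple graph with a co-comparability ordering ≺, let v ∈ V, and let I be an independent set containing v whose cardinality is maximum among all independent sets of G containing v. Then pos_I(v) = 1 + (the maximum cardinality of a left extension of v). -/
/-- In a co-comparability ordering, a left extension of `v` together with the vertices from `v`
onwards of an independent set containing `v` is again independent. -/
theorem IsLeftExt.isIndep_union {V : Type*} [LinearOrder V] {G : SimpleGraph V}
    (hco : ∀ u v w : V, u < v → v < w → ¬ G.Adj u v → ¬ G.Adj v w → ¬ G.Adj u w)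
    {v : V} {I L : Finset V} (hL : IsLeftExt G v L) (hI : IsIndep G I) (hvI : v ∈ I) :
    IsIndep G (L ∪ I.filter fun u => v ≤ u) := by
  have cross : ∀ u ∈ L, ∀ w ∈ I, v ≤ w → ¬ G.Adj u w := by
    intro u hu w hw hvw
    obtain ⟨huv, hadj⟩ := hL.2 u hu
    rcases hvw.eq_or_lt with rfl | hlt
    · exact hadj
    · exact hco u v w huv hlt hadj (hI v hvI w hw hlt.ne)
  intro a ha b hb hab
  simp only [Finset.mem_union, Finset.mem_filter] at ha hb
  rcases ha with ha | ha <;> rcases hb with hb | hb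
  · exact hL.1 a ha b hb hab
  · exact cross a ha b hb.1 hb.2
  · exact fun h => cross b hb a ha.1 ha.2 h.symm
  · exact hI a ha.1 b hb.1 hab

/-- The vertices of an independent set that precede one of its members `v` form a left extension
of `v`. -/
theorem IsIndep.isLeftExt_filter_lt {V : Type*} [LinearOrder V] {G : SimpleGraph V}
    {v : V} {I : Finset V} (hI : IsIndep G I) (hvI : v ∈ I) :
    IsLeftExt G v (I.filter fun u => u < v) := by
  refine ⟨fun a ha b hb => hI a (Finset.mem_filter.1 ha).1 b (Finset.mem_filter.1 hb).1,
    fun u hu => ?_⟩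
  obtain ⟨huI, huv⟩ := Finset.mem_filter.1 hu
  exact ⟨huv, hI u huI v hvI huv.ne⟩

/-- In a finite graph with a co-comparability ordering, if `I` is an
independent set containing `v` of maximum cardinality among independent sets containing
`v`, then `pos_I(v) = 1 + (max cardinality of a left extension of v)`. -/
theorem stmt9 {V : Type*} [Fintype V] [LinearOrder V] (G : SimpleGraph V)
    (hco : ∀ u v w : V, u < v → v < w → ¬ G.Adj u v → ¬ G.Adj v w → ¬ G.Adj u w)
    (v : V) (I : Finset V)
    (hI : IsIndep G I) (hvI : v ∈ I)
    (hmax : ∀ J : Finset V, IsIndep G J → v ∈ J → J.card ≤ I.card) :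
    posIn I v = 1 + leftExtNum G v := by
  have hgreatest : IsGreatest {n | ∃ L : Finset V, IsLeftExt G v L ∧ L.card = n}
      (I.filter fun u => u < v).card := by
    refine ⟨⟨_, hI.isLeftExt_filter_lt hvI, rfl⟩, ?_⟩
    rintro _ ⟨L, hL, rfl⟩
    have hle := hmax _ (hL.isIndep_union hco hI hvI)
      (Finset.mem_union_right _ (Finset.mem_filter.2 ⟨hvI, le_rfl⟩))
    have hdisj : Disjoint L (I.filter fun u => v ≤ u) :=
      Finset.disjoint_left.2 fun u hu hu' =>
        (hL.2 u hu).1.not_ge (Finset.mem_filter.1 hu').2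
    have hsplit := Finset.card_filter_add_card_filter_not (s := I) (fun u => u < v)
    simp only [not_lt] at hsplit
    rw [Finset.card_union_of_disjoint hdisj] at hle
    omega
  rw [posIn, leftExtNum, hgreatest.csSup_eq, add_comm]
end

section
/- Let G = (V,E) be a finite simple graph with a co-comparability ordering ≺, and let u, v ∈ V be distinct. Let β be the maximum cardinality of an independent set of G containing v, and let γ be the maximum cardinality of an independent set of G containing u, with β ≤ γ. Let I_v be an independent set of cardinality β containing v with p = pos_{I_v}(v), and let I_u be an independent set of cardinality γ containing u with q = pos_{I_u}(u). If p ≤ q ≤ p + (γ − β), then uv ∈ E. -/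
/-- Non-adjacent `a < b` let one glue the part of an independent set up to `a` to the part of
another one from `b` on. -/
theorem IsIndep.glue {V : Type*} [LinearOrder V] {G : SimpleGraph V}
    (hco : ∀ u v w : V, u < v → v < w → ¬ G.Adj u v → ¬ G.Adj v w → ¬ G.Adj u w)
    {a b : V} (hab : a < b) (hadj : ¬ G.Adj a b) {A B : Finset V}
    (hA : IsIndep G A) (haA : a ∈ A) (hB : IsIndep G B) (hbB : b ∈ B) :
    IsIndep G (A.filter (· ≤ a) ∪ B.filter (b ≤ ·)) := by
  have cross : ∀ x ∈ A, x ≤ a → ∀ y ∈ B, b ≤ y → ¬ G.Adj x y := by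
    intro x hx hxa y hy hby
    have hxb : ¬ G.Adj x b := by
      rcases hxa.eq_or_lt with rfl | hlt
      · exact hadj
      · exact hco x a b hlt hab (hA x hx a haA hlt.ne) hadj
    rcases hby.eq_or_lt with rfl | hlt
    · exact hxb
    · exact hco x b y (hxa.trans_lt hab) hlt hxb (hB b hbB y hy hlt.ne)
  intro x hx y hy hxy
  simp only [Finset.mem_union, Finset.mem_filter] at hx hy
  rcases hx with ⟨hx, hxa⟩ | ⟨hx, hbx⟩ <;> rcases hy with ⟨hy, hya⟩ | ⟨hy, hby⟩
  · exact hA x hx y hy hxy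
  · exact cross x hx hxa y hy hby
  · exact fun h => cross y hy hya x hx hbx h.symm
  · exact hB x hx y hy hxy

theorem card_filter_le_eq_posIn {V : Type*} [LinearOrder V] {A : Finset V} {a : V}
    (ha : a ∈ A) : (A.filter (· ≤ a)).card = posIn A a := by
  have h : A.filter (· ≤ a) = insert a (A.filter (· < a)) := by
    ext x
    simp only [Finset.mem_insert, Finset.mem_filter, le_iff_lt_or_eq]
    grind
  rw [h, Finset.card_insert_of_notMem (by simp), posIn]

theorem posIn_add_card_filter_ge {V : Type*} [LinearOrder V] (B : Finset V) (b : V) :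
    posIn B b + (B.filter (b ≤ ·)).card = B.card + 1 := by
  have h := B.card_filter_add_card_filter_not (· < b)
  simp only [not_lt] at h
  unfold posIn
  omega

theorem card_glue {V : Type*} [LinearOrder V] {a b : V} (hab : a < b) {A : Finset V}
    (haA : a ∈ A) (B : Finset V) :
    (A.filter (· ≤ a) ∪ B.filter (b ≤ ·)).card + posIn B b = posIn A a + B.card + 1 := by
  have hd : Disjoint (A.filter (· ≤ a)) (B.filter (b ≤ ·)) := by
    rw [Finset.disjoint_left]
    intro x hx hx'
    exact absurd ((Finset.mem_filter.1 hx').2.trans (Finset.mem_filter.1 hx).2) hab.not_ge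
  rw [Finset.card_union_of_disjoint hd, card_filter_le_eq_posIn haA]
  have := posIn_add_card_filter_ge B b
  omega

/-- In a finite graph with a co-comparability ordering, let `u ≠ v`,
let `β` (resp. `γ`) be the maximum cardinality of an independent set containing `v`
(resp. `u`), with `β ≤ γ`. Let `I_v` be an independent set of cardinality `β`
containing `v` with `p = pos_{I_v}(v)`, and `I_u` an independent set of cardinality `γ`
containing `u` with `q = pos_{I_u}(u)`. If `p ≤ q ≤ p + (γ - β)` then `uv ∈ E`. -/
theorem stmt12 {V : Type*} [Fintype V] [LinearOrder V] (G : SimpleGraph V)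
    (hco : ∀ u v w : V, u < v → v < w → ¬ G.Adj u v → ¬ G.Adj v w → ¬ G.Adj u w)
    (u v : V) (huv : u ≠ v) (β γ : ℕ) (hβγ : β ≤ γ)
    (Iv : Finset V) (hIv : IsIndep G Iv) (hvIv : v ∈ Iv) (hIvcard : Iv.card = β)
    (hβmax : ∀ J : Finset V, IsIndep G J → v ∈ J → J.card ≤ β)
    (Iu : Finset V) (hIu : IsIndep G Iu) (huIu : u ∈ Iu) (hIucard : Iu.card = γ)
    (hγmax : ∀ J : Finset V, IsIndep G J → u ∈ J → J.card ≤ γ)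
    (p q : ℕ) (hp : p = posIn Iv v) (hq : q = posIn Iu u)
    (hpq : p ≤ q) (hqpg : q ≤ p + (γ - β)) :
    G.Adj u v := by
  by_contra hadj
  rcases huv.lt_or_gt with hlt | hlt
  · have hJ := hβmax _ (IsIndep.glue hco hlt hadj hIu huIu hIv hvIv)
      (Finset.mem_union_right _ (Finset.mem_filter.2 ⟨hvIv, le_rfl⟩))
    have := card_glue hlt huIu Iv
    omega
  · have hJ := hβmax _ (IsIndep.glue hco hlt (fun h => hadj h.symm) hIv hvIv hIu huIu)
      (Finset.mem_union_left _ (Finset.mem_filter.2 ⟨hvIv, le_rfl⟩))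
    have := card_glue hlt hvIv Iu
    omega
end

section
/- Let G = (V,E) be a finite simple graph with a co-comparability ordering ≺, and let u, v ∈ V be distinct with uv ∉ E. Let I_u be an independent set containing u of maximum cardinality among independent sets containing u, and let I_v be an independent set containing v of maximum cardinality among independent sets containing v. If pos_{I_u}(u) < pos_{I_v}(v), then u ≺ v. -/
/-- In a co-comparability ordering, the part of an independent set up to its member `v` and the
part of another one from its member `u` on have an independent union if `v < u` and `uv ∉ E`. -/
theorem IsIndep.filter_union_filter {V : Type*} [LinearOrder V] {G : SimpleGraph V}
    (hco : ∀ u v w : V, u < v → v < w → ¬ G.Adj u v → ¬ G.Adj v w → ¬ G.Adj u w)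
    {u v : V} (hvu : v < u) (hnadj : ¬ G.Adj v u) {I J : Finset V}
    (hI : IsIndep G I) (hv : v ∈ I) (hJ : IsIndep G J) (hu : u ∈ J) :
    IsIndep G ((I.filter fun x => x ≤ v) ∪ J.filter fun x => u ≤ x) := by
  have cross : ∀ x ∈ I, x ≤ v → ∀ y ∈ J, u ≤ y → ¬ G.Adj x y := by
    intro x hx hxv y hy huy
    have hxu : ¬ G.Adj x u := by
      rcases hxv.eq_or_lt with rfl | h
      · exact hnadj
      · exact hco x v u h hvu (hI x hx v hv h.ne) hnadj
    rcases huy.eq_or_lt with rfl | h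
    · exact hxu
    · exact hco x u y (hxv.trans_lt hvu) h hxu (hJ u hu y hy h.ne)
  intro x hx y hy hxy
  simp only [Finset.mem_union, Finset.mem_filter] at hx hy
  rcases hx with ⟨hx, hxv⟩ | ⟨hx, hux⟩ <;> rcases hy with ⟨hy, hyv⟩ | ⟨hy, huy⟩
  · exact hI x hx y hy hxy
  · exact cross x hx hxv y hy huy
  · exact fun h => cross y hy hyv x hx hux h.symm
  · exact hJ x hx y hy hxy

/-- The members of `I` up to `v ∈ I` number `posIn I v`. -/
theorem card_filter_le_eq_posIn_s13 {V : Type*} [LinearOrder V] {I : Finset V} {v : V}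
    (hv : v ∈ I) : (I.filter fun x => x ≤ v).card = posIn I v := by
  have h : (I.filter fun x => x ≤ v) = insert v (I.filter fun x => x < v) := by
    ext x
    grind
  rw [h, Finset.card_insert_of_notMem (by simp), posIn]

/-- In a finite graph with a co-comparability ordering, let `u ≠ v` with
`uv ∉ E`, let `I_u` (resp. `I_v`) be an independent set containing `u` (resp. `v`) of
maximum cardinality among independent sets containing `u` (resp. `v`).
If `pos_{I_u}(u) < pos_{I_v}(v)` then `u ≺ v`. -/
theorem stmt13 {V : Type*} [Fintype V] [LinearOrder V] (G : SimpleGraph V)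
    (hco : ∀ u v w : V, u < v → v < w → ¬ G.Adj u v → ¬ G.Adj v w → ¬ G.Adj u w)
    (u v : V) (huv : u ≠ v) (hnadj : ¬ G.Adj u v)
    (Iu : Finset V) (hIu : IsIndep G Iu) (huIu : u ∈ Iu)
    (hIumax : ∀ J : Finset V, IsIndep G J → u ∈ J → J.card ≤ Iu.card)
    (Iv : Finset V) (hIv : IsIndep G Iv) (hvIv : v ∈ Iv)
    (hIvmax : ∀ J : Finset V, IsIndep G J → v ∈ J → J.card ≤ Iv.card)
    (hpos : posIn Iu u < posIn Iv v) :
    u < v := by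
  by_contra hle
  have hvu : v < u := lt_of_le_of_ne (not_lt.mp hle) huv.symm
  have hcard := hIumax _
    (hIv.filter_union_filter hco hvu (fun h => hnadj h.symm) hvIv hIu huIu)
    (by simp [huIu])
  rw [Finset.card_union_of_disjoint, card_filter_le_eq_posIn_s13 hvIv] at hcard
  · have hsplit := Iu.card_filter_add_card_filter_not (fun x => x < u)
    simp only [not_lt] at hsplit
    unfold posIn at hpos hcard
    omega
  · rw [Finset.disjoint_left]
    intro x hx hx'
    exact absurd (Finset.mem_filter.mp hx).2
      (not_le.mpr (hvu.trans_le (Finset.mem_filter.mp hx').2))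
end
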